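/- Let {·,·} be the bracket on ℂ[x₁, …, x₆] determined as an antisymmetric biderivation by {x₁,x₂} = −3x₁x₂, {x₁,x₃} = −6x₂³ − 3x₁x₃, {x₁,x₄} = 3x₁x₄, {x₁,x₅} = −6x₂²x₄ + 3x₁x₅, {x₁,x₆} = −18x₂²x₅² + 6x₁x₆ − 18x₂x₅ + 6x₃x₄ − 6, {x₂,x₃} = −3x₂x₃, {x₂,x₄} = 3x₂x₄, {x₂,x₅} = 2x₂x₅ − 2x₃x₄ + 2, {x₂,x₆} = −6x₃x₅² + 3x₂x₆, {x₃,x₄} = 6x₃x₄ − 6, {x₃,x₅} = 3x₃x₅, {x₃,x₆} = 3x₃x₆, {x₄,x₅} = −3x₄x₅, {x₄,x₆} = −6x₅³ − 3x₄x₆, {x₅,x₆} = −3x₅x₆. Put y₁ = x₃x₄ − 1, y₂ = x₂x₅ − x₃x₄ + 1, and y₃ = x₁x₃x₄x₆ − x₂³x₄x₆ − x₁x₆ − x₁x₃x₅³ + x₂³x₅³ + 3x₂²x₅² − 3x₂x₃x₄x₅ + 3x₂x₅ + x₃²x₄² − 2x₃x₄ + 1. Then {y_i, y_j} = 0 for all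 i, j ∈ {1, 2, 3}. -/

import Mathlib

noncomputable section

open MvPolynomial

/-- The bracket on `ℂ[x₁, …, x_N]` associated to coefficients `c i j`
(`i < j`), which is the unique antisymmetric biderivation with
`{xᵢ, xⱼ} = c i j`. -/
def pbracket {N : ℕ} (c : Fin N → Fin N → MvPolynomial (Fin N) ℂ)
    (f g : MvPolynomial (Fin N) ℂ) : MvPolynomial (Fin N) ℂ :=
  ∑ i : Fin N, ∑ j : Fin N,
    if (i : ℕ) < (j : ℕ) then
      c i j * (pderiv i f * pderiv j g - pderiv j f * pderiv i g)
    else 0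

/-- Coefficients of the standard Poisson bracket on the generalized Bruhat cell
of `G₂` associated to `(s₂, s₁, s₂, s₂, s₁, s₂)` (variables
`x₁, …, x₆` are `X 0, …, X 5`). -/
def c6 : Fin 6 → Fin 6 → MvPolynomial (Fin 6) ℂ := fun i j =>
  if i = 0 ∧ j = 1 then -3 * X 0 * X 1
  else if i = 0 ∧ j = 2 then -6 * X 1 ^ 3 - 3 * X 0 * X 2
  else if i = 0 ∧ j = 3 then 3 * X 0 * X 3
  else if i = 0 ∧ j = 4 then -6 * X 1 ^ 2 * X 3 + 3 * X 0 * X 4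
  else if i = 0 ∧ j = 5 then
    -18 * X 1 ^ 2 * X 4 ^ 2 + 6 * X 0 * X 5 - 18 * X 1 * X 4 + 6 * X 2 * X 3 - 6
  else if i = 1 ∧ j = 2 then -3 * X 1 * X 2
  else if i = 1 ∧ j = 3 then 3 * X 1 * X 3
  else if i = 1 ∧ j = 4 then 2 * X 1 * X 4 - 2 * X 2 * X 3 + 2
  else if i = 1 ∧ j = 5 then -6 * X 2 * X 4 ^ 2 + 3 * X 1 * X 5
  else if i = 2 ∧ j = 3 then 6 * X 2 * X 3 - 6
  else if i = 2 ∧ j = 4 then 3 * X 2 * X 4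
  else if i = 2 ∧ j = 5 then 3 * X 2 * X 5
  else if i = 3 ∧ j = 4 then -3 * X 3 * X 4
  else if i = 3 ∧ j = 5 then -6 * X 4 ^ 3 - 3 * X 3 * X 5
  else if i = 4 ∧ j = 5 then -3 * X 4 * X 5
  else 0

/-- `y₁ = x₃x₄ - 1`. -/
def y1g : MvPolynomial (Fin 6) ℂ := X 2 * X 3 - 1

/-- `y₂ = x₂x₅ - x₃x₄ + 1`. -/
def y2g : MvPolynomial (Fin 6) ℂ := X 1 * X 4 - X 2 * X 3 + 1

/-- `y₃ = x₁x₃x₄x₆ - x₂³x₄x₆ - x₁x₆ - x₁x₃x₅³ + x₂³x₅³ + 3x₂²x₅² - 3x₂x₃x₄x₅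
            + 3x₂x₅ + x₃²x₄² - 2x₃x₄ + 1`. -/
def y3g : MvPolynomial (Fin 6) ℂ :=
  X 0 * X 2 * X 3 * X 5 - X 1 ^ 3 * X 3 * X 5 - X 0 * X 5 - X 0 * X 2 * X 4 ^ 3
    + X 1 ^ 3 * X 4 ^ 3 + 3 * X 1 ^ 2 * X 4 ^ 2 - 3 * X 1 * X 2 * X 3 * X 4
    + 3 * X 1 * X 4 + X 2 ^ 2 * X 3 ^ 2 - 2 * X 2 * X 3 + 1

lemma pbracket_self (f : MvPolynomial (Fin 6) ℂ) : pbracket c6 f f = 0 := by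
  unfold pbracket
  refine Finset.sum_eq_zero fun i _ => Finset.sum_eq_zero fun j _ => ?_
  split_ifs
  · ring
  · rfl

lemma pbracket_swap (f g : MvPolynomial (Fin 6) ℂ) (h : pbracket c6 f g = 0) :
    pbracket c6 g f = 0 := by
  have : pbracket c6 g f = - pbracket c6 f g := by
    unfold pbracket
    simp only [← Finset.sum_neg_distrib]
    refine Finset.sum_congr rfl fun i _ => Finset.sum_congr rfl fun j _ => ?_
    split_ifs
    · ring
    · simp
  rw [this, h, neg_zero]

lemma pderiv_two (i : Fin 6) : pderiv i (2 : MvPolynomial (Fin 6) ℂ) = 0 :=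
  (pderiv i).map_natCast 2

lemma pderiv_three (i : Fin 6) : pderiv i (3 : MvPolynomial (Fin 6) ℂ) = 0 :=
  (pderiv i).map_natCast 3

lemma y12 : pbracket c6 y1g y2g = 0 := by
  simp [pbracket, Fin.sum_univ_six, c6, y1g, y2g, pderiv_X, Pi.single_apply]
  ring

lemma y13 : pbracket c6 y1g y3g = 0 := by
  simp [pbracket, Fin.sum_univ_six, c6, y1g, y3g, pderiv_X, Pi.single_apply, pderiv_two, pderiv_three,
    Derivation.leibniz_pow]
  ring

lemma y23 : pbracket c6 y2g y3g = 0 := by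
  simp [pbracket, Fin.sum_univ_six, c6, y2g, y3g, pderiv_X, Pi.single_apply, pderiv_two, pderiv_three,
    Derivation.leibniz_pow]
  ring

/-- The functions `y₁, y₂, y₃` pairwise Poisson commute with respect to the
`G₂` bracket. -/
theorem stmt_12 :
    ∀ i j : Fin 3, pbracket c6 (![y1g, y2g, y3g] i) (![y1g, y2g, y3g] j) = 0 := by
  intro i j
  fin_cases i <;> fin_cases j
  · exact pbracket_self _
  · exact y12
  · exact y13
  · exact pbracket_swap _ _ y12
  · exact pbracket_self _
  · exact y23
  · exact pbracket_swap _ _ y13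
  · exact pbracket_swap _ _ y23
  · exact pbracket_self _
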